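/- arXiv:0802.3209 — 2 statements merged into one kernel-verified Lean document; each statement's English description precedes it below -/
import Mathlib

section
/- Let A = (a_{ij})_{i,j=1}^{2} be a 2×2 matrix of constant complex entries with zero trace, i.e. a_{11} + a_{22} = 0. Then for every complex-valued function u ∈ C_0^∞(ℝ²) one has |∫_{ℝ²} Σ_{i,j=1}^{2} a_{ij} (∂u/∂x_i)(conj(∂u/∂x_j)) dx| ≤ (1/(4π)) · max_{ω ∈ S¹} |Σ_{i,j=1}^{2} a_{ij} ω_i ω_j| · (∫_{ℝ²} |Δu| dx)², where S¹ is the unit circle in ℝ² and Δ is the Laplacian. -/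
open MeasureTheory
open scoped Real

noncomputable section

/-- Euclidean plane. -/
abbrev E2 := EuclideanSpace ℝ (Fin 2)

/-- Partial derivative of a complex-valued function on `ℝ²` in the `i`-th coordinate
direction. -/
def pd (i : Fin 2) (u : E2 → ℂ) (x : E2) : ℂ :=
  fderiv ℝ u x (EuclideanSpace.single i 1)

/-- The Laplacian of a complex-valued function on `ℝ²`. -/
def lap (u : E2 → ℂ) (x : E2) : ℂ :=
  pd 0 (pd 0 u) x + pd 1 (pd 1 u) x

open Filter Topology

/-- The first-order operator `∂₀ + J ∂₁`, a Wirtinger derivative (up to a factor `2`) when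
`J = ± I`. -/
def wd (J : ℂ) (u : E2 → ℂ) (x : E2) : ℂ := pd 0 u x + J * pd 1 u x

lemma contDiff_pd {u : E2 → ℂ} (hu : ContDiff ℝ (⊤ : ℕ∞) u) (i : Fin 2) :
    ContDiff ℝ (⊤ : ℕ∞) (pd i u) :=
  (hu.fderiv_right (m := (⊤ : ℕ∞)) (by simp)).clm_apply contDiff_const

lemma contDiff_wd {u : E2 → ℂ} (hu : ContDiff ℝ (⊤ : ℕ∞) u) (J : ℂ) :
    ContDiff ℝ (⊤ : ℕ∞) (wd J u) :=
  (contDiff_pd hu 0).add (contDiff_const.mul (contDiff_pd hu 1))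

lemma hasCompactSupport_pd {u : E2 → ℂ} (hu : HasCompactSupport u) (i : Fin 2) :
    HasCompactSupport (pd i u) :=
  hu.fderiv_apply (𝕜 := ℝ) _

lemma hasCompactSupport_wd {u : E2 → ℂ} (hu : HasCompactSupport u) (J : ℂ) :
    HasCompactSupport (wd J u) :=
  (hasCompactSupport_pd hu 0).add ((hasCompactSupport_pd hu 1).mul_left)

lemma pd_comm {u : E2 → ℂ} (hu : ContDiff ℝ (⊤ : ℕ∞) u) (x : E2) :
    pd 0 (pd 1 u) x = pd 1 (pd 0 u) x := by
  have hd : DifferentiableAt ℝ (fderiv ℝ u) x :=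
    ((hu.fderiv_right (m := (⊤ : ℕ∞)) (by simp)).differentiable (by simp)) x
  have hs : IsSymmSndFDerivAt ℝ u x :=
    (contDiff_infty.mp hu 2).contDiffAt.isSymmSndFDerivAt (by simp)
  have key : ∀ i j : Fin 2, pd i (pd j u) x =
      fderiv ℝ (fderiv ℝ u) x (EuclideanSpace.single i 1) (EuclideanSpace.single j 1) := by
    intro i j
    unfold pd
    rw [fderiv_clm_apply hd (by fun_prop)]
    simp
  rw [key, key, hs]

lemma wd_mul {f g : E2 → ℂ} {x : E2} (J : ℂ) (hf : DifferentiableAt ℝ f x)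
    (hg : DifferentiableAt ℝ g x) :
    wd J (fun y => f y * g y) x = wd J f x * g x + f x * wd J g x := by
  simp only [wd, pd]
  rw [fderiv_fun_mul hf hg]
  simp
  ring

lemma wd_add {f g : E2 → ℂ} {x : E2} (J : ℂ) (hf : DifferentiableAt ℝ f x)
    (hg : DifferentiableAt ℝ g x) :
    wd J (fun y => f y + g y) x = wd J f x + wd J g x := by
  simp only [wd, pd]
  rw [fderiv_fun_add hf hg]
  simp
  ring

lemma wd_const (J a : ℂ) (x : E2) : wd J (fun _ => a) x = 0 := by
  simp [wd, pd]

lemma wd_div {f g : E2 → ℂ} {x : E2} (J : ℂ) (hf : DifferentiableAt ℝ f x)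
    (hg : Differentiable ℝ g) (h0 : ∀ y, g y ≠ 0) :
    wd J (fun y => f y / g y) x = (wd J f x * g x - f x * wd J g x) / g x ^ 2 := by
  have hq : DifferentiableAt ℝ (fun y => f y / g y) x := by
    simp only [div_eq_mul_inv]
    exact hf.mul ((hg x).inv (h0 x))
  have h := wd_mul J hq (hg x)
  have e : (fun y => f y / g y * g y) = f := by
    funext y; exact div_mul_cancel₀ _ (h0 y)
  rw [e] at h
  have := h0 x
  rw [h]
  field_simp
  ring

lemma wd_wd_neg {u : E2 → ℂ} (hu : ContDiff ℝ (⊤ : ℕ∞) u) {J : ℂ} (hJ : J * J = -1) (x : E2) :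
    wd J (wd (-J) u) x = lap u x := by
  have h0 : DifferentiableAt ℝ (pd 0 u) x := (contDiff_pd hu 0).differentiable (by simp) x
  have h1 : DifferentiableAt ℝ (pd 1 u) x := (contDiff_pd hu 1).differentiable (by simp) x
  have e : wd (-J) u = fun y => pd 0 u y + (fun _ => -J) y * pd 1 u y := rfl
  rw [e, wd_add J h0 (h1.const_mul _), wd_mul J (by fun_prop) h1, wd_const]
  simp only [wd, lap, pd_comm hu]
  linear_combination (-pd 1 (pd 1 u) x) * hJ

lemma integral_pd_mul {f g : E2 → ℂ} (hf : ContDiff ℝ (⊤ : ℕ∞) f) (hfs : HasCompactSupport f)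
    (hg : ContDiff ℝ (⊤ : ℕ∞) g) (i : Fin 2) :
    ∫ x, pd i f x * g x = -∫ x, f x * pd i g x := by
  have h1 : Integrable (fun x => pd i f x * g x) :=
    ((contDiff_pd hf i).continuous.mul hg.continuous).integrable_of_hasCompactSupport
      (hasCompactSupport_pd hfs i).mul_right
  have h2 : Integrable (fun x => f x * pd i g x) :=
    (hf.continuous.mul (contDiff_pd hg i).continuous).integrable_of_hasCompactSupport
      hfs.mul_right
  have h3 : Integrable (fun x => f x * g x) :=
    (hf.continuous.mul hg.continuous).integrable_of_hasCompactSupport hfs.mul_right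
  have := integral_mul_fderiv_eq_neg_fderiv_mul_of_integrable (μ := volume)
    (v := EuclideanSpace.single i 1) h1 h2 h3
    (fun x _ => hf.differentiable (by simp) x) (fun x _ => hg.differentiable (by simp) x)
  simp only [pd] at *
  rw [this, neg_neg]

lemma integral_wd_mul {f g : E2 → ℂ} (hf : ContDiff ℝ (⊤ : ℕ∞) f) (hfs : HasCompactSupport f)
    (hg : ContDiff ℝ (⊤ : ℕ∞) g) (J : ℂ) :
    ∫ x, wd J f x * g x = -∫ x, f x * wd J g x := by
  have h1 (i : Fin 2) : Integrable (fun x => pd i f x * g x) :=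
    ((contDiff_pd hf i).continuous.mul hg.continuous).integrable_of_hasCompactSupport
      (hasCompactSupport_pd hfs i).mul_right
  have h2 (i : Fin 2) : Integrable (fun x => f x * pd i g x) :=
    (hf.continuous.mul (contDiff_pd hg i).continuous).integrable_of_hasCompactSupport
      hfs.mul_right
  have e1 : (fun x => wd J f x * g x) =
      fun x => pd 0 f x * g x + J * (pd 1 f x * g x) := by
    funext x; simp only [wd]; ring
  have e2 : (fun x => f x * wd J g x) =
      fun x => f x * pd 0 g x + J * (f x * pd 1 g x) := by
    funext x; simp only [wd]; ring
  rw [e1, e2, integral_add (h1 0) ((h1 1).const_mul J), integral_add (h2 0) ((h2 1).const_mul J),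
    integral_const_mul, integral_const_mul, integral_pd_mul hf hfs hg, integral_pd_mul hf hfs hg]
  ring

lemma wd_comp_sub_right (J : ℂ) (f : E2 → ℂ) (z x : E2) :
    wd J (fun y => f (y - z)) x = wd J f (x - z) := by
  simp only [wd, pd, fderiv_comp_sub]

lemma wd_comp_sub_left (J : ℂ) {f : E2 → ℂ} (hf : Differentiable ℝ f) (y x : E2) :
    wd J (fun z => f (y - z)) x = -wd J f (y - x) := by
  have h : HasFDerivAt (fun z => f (y - z))
      ((fderiv ℝ f (y - x)).comp (-(ContinuousLinearMap.id ℝ E2))) x :=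
    (hf (y - x)).hasFDerivAt.comp x ((hasFDerivAt_id x).const_sub y)
  simp only [wd, pd, h.fderiv]
  simp
  ring

lemma integrable_kernel {f g k : E2 → ℂ} (hf : Continuous f) (hfs : HasCompactSupport f)
    (hg : Continuous g) (hgs : HasCompactSupport g) (hk : Continuous k) :
    Integrable (fun q : E2 × E2 => f q.1 * g q.2 * k (q.1 - q.2)) (volume.prod volume) := by
  apply Continuous.integrable_of_hasCompactSupport (by fun_prop)
  refine HasCompactSupport.intro (K := tsupport f ×ˢ tsupport g) (hfs.isCompact.prod hgs.isCompact) ?_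
  intro q hq
  rw [Set.mem_prod, not_and_or] at hq
  rcases hq with h | h <;> simp [image_eq_zero_of_notMem_tsupport h]

/-- Integrating by parts once in each variable against a difference kernel. -/
lemma integral_wd_wd_kernel {f g k : E2 → ℂ} (hf : ContDiff ℝ (⊤ : ℕ∞) f)
    (hfs : HasCompactSupport f) (hg : ContDiff ℝ (⊤ : ℕ∞) g) (hgs : HasCompactSupport g)
    (hk : ContDiff ℝ (⊤ : ℕ∞) k) (J : ℂ) :
    ∫ y, ∫ z, wd J f y * wd J g z * k (y - z) =
      -∫ z, ∫ y, f y * g z * wd J (wd J k) (y - z) := by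
  have h1 (y : E2) : ∫ z, wd J f y * wd J g z * k (y - z) =
      ∫ z, wd J f y * g z * wd J k (y - z) := by
    simp only [mul_assoc, integral_const_mul]
    rw [integral_wd_mul hg hgs (g := fun z => k (y - z)) (hk.comp (by fun_prop))]
    simp only [wd_comp_sub_left J (hk.differentiable (by simp)), mul_neg, integral_neg, neg_neg]
  simp only [h1]
  rw [integral_integral_swap (integrable_kernel (contDiff_wd hf J).continuous
    (hasCompactSupport_wd hfs J) hg.continuous hgs (contDiff_wd hk J).continuous), ← integral_neg]
  congr 1; funext z
  have e1 : (fun y => wd J f y * g z * wd J k (y - z)) =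
      fun y => g z * (wd J f y * wd J k (y - z)) := by funext y; ring
  have e2 : (fun y => f y * g z * wd J (wd J k) (y - z)) =
      fun y => g z * (f y * wd J (wd J k) (y - z)) := by funext y; ring
  rw [e1, e2, integral_const_mul, integral_const_mul,
    integral_wd_mul hf hfs (g := fun y => wd J k (y - z))
      ((contDiff_wd hk J).comp (by fun_prop))]
  simp only [wd_comp_sub_right]
  ring

/-- A regularisation of `(x₀ - J x₁)² / |x|²`. -/
def regKernel (J : ℂ) (c : ℝ) (x : E2) : ℂ :=
  (c : ℂ) ^ 2 * ((x 0 : ℂ) - J * x 1) ^ 2 / ((c : ℂ) ^ 2 * ((x 0 : ℂ) ^ 2 + (x 1 : ℂ) ^ 2) + 1)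

/-- A probability density on the plane. -/
def peak (x : E2) : ℝ := 2 / (π * (1 + ‖x‖ ^ 2) ^ 3)

lemma norm_sq_eq (x : E2) : ‖x‖ ^ 2 = x 0 ^ 2 + x 1 ^ 2 := by
  simp [EuclideanSpace.norm_sq_eq]

lemma regKernel_den_eq (c : ℝ) (x : E2) :
    (c : ℂ) ^ 2 * ((x 0 : ℂ) ^ 2 + (x 1 : ℂ) ^ 2) + 1 = ((c ^ 2 * ‖x‖ ^ 2 + 1 : ℝ) : ℂ) := by
  rw [norm_sq_eq]; push_cast; ring

lemma regKernel_den_ne (c : ℝ) (x : E2) :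
    (c : ℂ) ^ 2 * ((x 0 : ℂ) ^ 2 + (x 1 : ℂ) ^ 2) + 1 ≠ 0 := by
  rw [regKernel_den_eq]
  exact_mod_cast (by positivity : (c ^ 2 * ‖x‖ ^ 2 + 1 : ℝ) ≠ 0)

lemma contDiff_coord (i : Fin 2) : ContDiff ℝ (⊤ : ℕ∞) (fun x : E2 => (x i : ℂ)) :=
  (Complex.ofRealCLM.comp (EuclideanSpace.proj i : E2 →L[ℝ] ℝ)).contDiff

lemma contDiff_regKernel (J : ℂ) (c : ℝ) : ContDiff ℝ (⊤ : ℕ∞) (regKernel J c) := by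
  have h0 := contDiff_coord 0
  have h1 := contDiff_coord 1
  unfold regKernel
  simp only [div_eq_mul_inv]
  exact (contDiff_const.mul ((h0.sub (contDiff_const.mul h1)).pow 2)).mul
    (((contDiff_const.mul ((h0.pow 2).add (h1.pow 2))).add contDiff_const).inv
      (regKernel_den_ne c))

lemma wd_coord (J a b : ℂ) (x : E2) : wd J (fun x : E2 => a * x 0 + b * x 1) x = a + J * b := by
  have h (i j : Fin 2) : pd i (fun x : E2 => (x j : ℂ)) x = if j = i then 1 else 0 := by
    have : HasFDerivAt (fun x : E2 => (x j : ℂ))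
      (Complex.ofRealCLM.comp (EuclideanSpace.proj j : E2 →L[ℝ] ℝ)) x :=
      (Complex.ofRealCLM.comp (EuclideanSpace.proj j : E2 →L[ℝ] ℝ)).hasFDerivAt
    simp only [pd, this.fderiv]
    split_ifs with hij <;> simp [hij]
  have d (j : Fin 2) : DifferentiableAt ℝ (fun x : E2 => (x j : ℂ)) x :=
    (contDiff_coord j).differentiable (by simp) x
  rw [wd_add J ((d 0).const_mul a) ((d 1).const_mul b), wd_mul J (by fun_prop) (d 0),
    wd_mul J (by fun_prop) (d 1), wd_const, wd_const]
  simp [wd, h]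
  ring

lemma wd_wd_regKernel {J : ℂ} (hJ : J * J = -1) (c : ℝ) (x : E2) :
    wd J (wd J (regKernel J c)) x =
      8 * (c : ℂ) ^ 2 / ((c : ℂ) ^ 2 * ((x 0 : ℂ) ^ 2 + (x 1 : ℂ) ^ 2) + 1) ^ 3 := by
  set t : E2 → ℂ := fun x => 1 * x 0 + (-J) * x 1 with ht
  set s : E2 → ℂ := fun x => 1 * x 0 + J * x 1 with hs
  have dt : Differentiable ℝ t := by
    have h0 := (contDiff_coord 0).differentiable (by simp)
    have h1 := (contDiff_coord 1).differentiable (by simp)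
    exact (h0.const_mul _).add (h1.const_mul _)
  have ds : Differentiable ℝ s := by
    have h0 := (contDiff_coord 0).differentiable (by simp)
    have h1 := (contDiff_coord 1).differentiable (by simp)
    exact (h0.const_mul _).add (h1.const_mul _)
  have wt (x) : wd J t x = 2 := by
    rw [ht, wd_coord]; linear_combination -hJ
  have ws (x) : wd J s x = 0 := by
    rw [hs, wd_coord]; linear_combination hJ
  set d : E2 → ℂ := fun x => (c : ℂ) ^ 2 * (t x * s x) + 1 with hd
  have hts (x) : t x * s x = (x 0 : ℂ) ^ 2 + (x 1 : ℂ) ^ 2 := by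
    simp only [ht, hs]; linear_combination (-(x 1 : ℂ) ^ 2) * hJ
  have d0 (x) : d x ≠ 0 := by
    simp only [hd, hts]; exact regKernel_den_ne c x
  have dd : Differentiable ℝ d := by fun_prop
  have wdd (x) : wd J d x = 2 * (c : ℂ) ^ 2 * s x := by
    rw [hd, wd_add J (by fun_prop) (by fun_prop), wd_mul J (by fun_prop) (by fun_prop),
      wd_mul J (by fun_prop) (by fun_prop), wd_const, wd_const, wt, ws]
    ring
  have wtt (x) : wd J (fun x => t x * t x) x = 4 * t x := by
    rw [wd_mul J (by fun_prop) (by fun_prop), wt]; ring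
  have e : regKernel J c = fun x => (c : ℂ) ^ 2 * (t x * t x) / d x := by
    funext x
    simp only [regKernel, hd, hts]
    simp only [ht]; ring
  have w1 : wd J (regKernel J c) =
      fun x => 2 * (c : ℂ) ^ 2 * ((t x * t x) * ((c : ℂ) ^ 2 * s x) + 2 * t x) / (d x * d x) := by
    funext x
    rw [e, wd_div J (by fun_prop) dd d0, wd_mul J (by fun_prop) (by fun_prop), wd_const, wdd, wtt]
    have := d0 x
    field_simp
    simp only [hd]
    ring
  rw [w1, wd_div J (by fun_prop) (by fun_prop) (fun y => mul_ne_zero (d0 y) (d0 y)),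
    wd_mul J (by fun_prop) (by fun_prop), wd_const, wd_mul J (by fun_prop) (by fun_prop),
    wd_add J (by fun_prop) (by fun_prop), wd_mul J (by fun_prop) (by fun_prop), wtt,
    wd_mul J (by fun_prop) (by fun_prop), wd_const, wd_mul J (by fun_prop) (by fun_prop), wd_const,
    wt, ws, wdd]
  rw [← hts, show (c : ℂ) ^ 2 * (t x * s x) + 1 = d x from rfl]
  have := d0 x
  field_simp
  simp only [hd]
  ring

lemma wd_wd_regKernel_eq_peak {J : ℂ} (hJ : J * J = -1) (c : ℝ) (x : E2) :
    wd J (wd J (regKernel J c)) x = 4 * π * ((c ^ 2 * peak (c • x) : ℝ) : ℂ) := by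
  rw [wd_wd_regKernel hJ, regKernel_den_eq, peak, norm_smul, mul_pow, Real.norm_eq_abs, sq_abs]
  have h : (c ^ 2 * ‖x‖ ^ 2 + 1 : ℝ) ≠ 0 := by positivity
  have h2 : (1 + c ^ 2 * ‖x‖ ^ 2 : ℝ) ≠ 0 := by positivity
  have hp := Real.pi_ne_zero
  rw [add_comm (c ^ 2 * ‖x‖ ^ 2) 1]
  norm_cast
  field_simp
  ring

lemma continuous_peak : Continuous peak := by
  unfold peak
  exact continuous_const.div (by fun_prop) (fun x => by positivity)

lemma peak_nonneg (x : E2) : 0 ≤ peak x := by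
  unfold peak; positivity

lemma integral_peak : ∫ x, peak x = 1 := by
  have h := integral_fun_norm_addHaar (volume : Measure E2)
    (fun r : ℝ => 2 / (π * (1 + r ^ 2) ^ 3))
  have hv : (volume : Measure E2).real (Metric.ball 0 1) = π := by
    simp [Measure.real, Real.pi_pos.le]
  have hI : ∫ y in Set.Ioi (0 : ℝ), y * (2 / (π * (1 + y ^ 2) ^ 3)) = 1 / (2 * π) := by
    have hd : ∀ y ∈ Set.Ici (0 : ℝ), HasDerivAt (fun y : ℝ => -(1 / (2 * π)) * ((1 + y ^ 2) ^ 2)⁻¹)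
        (y * (2 / (π * (1 + y ^ 2) ^ 3))) y := by
      intro y _
      have h0 : (1 + y ^ 2) ≠ 0 := by positivity
      have h1 : HasDerivAt (fun y : ℝ => (1 + y ^ 2) ^ 2)
          (2 * (1 + y ^ 2) * (2 * y)) y := by
        have := (((hasDerivAt_id y).fun_pow 2).const_add 1).fun_pow 2
        simpa using this
      have h2 := (h1.fun_inv (pow_ne_zero 2 h0)).const_mul (-(1 / (2 * π)))
      refine h2.congr_deriv ?_
      have := Real.pi_ne_zero
      field_simp
    have ht : Tendsto (fun y : ℝ => -(1 / (2 * π)) * ((1 + y ^ 2) ^ 2)⁻¹) atTop (𝓝 0) := by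
      have : Tendsto (fun y : ℝ => (1 + y ^ 2) ^ 2) atTop atTop :=
        (tendsto_pow_atTop two_ne_zero).comp
          (tendsto_atTop_add_const_left _ _ (tendsto_pow_atTop two_ne_zero))
      simpa using this.inv_tendsto_atTop.const_mul (-(1 / (2 * π)))
    rw [integral_Ioi_of_hasDerivAt_of_nonneg' hd (fun y hy => ?_) ht]
    · simp
    · have : 0 < y := hy
      positivity
  simp only [peak]
  rw [h, hv]
  simp only [finrank_euclideanSpace, Fintype.card_fin, smul_eq_mul, nsmul_eq_mul]
  norm_num
  rw [hI]
  have := Real.pi_ne_zero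
  field_simp

lemma tendsto_norm_sq_mul_peak :
    Tendsto (fun x : E2 => ‖x‖ ^ Module.finrank ℝ E2 * peak x) (Bornology.cobounded E2) (𝓝 0) := by
  have h : Tendsto (fun r : ℝ => r ^ 2 * (2 / (π * (1 + r ^ 2) ^ 3))) atTop (𝓝 0) := by
    refine squeeze_zero' (Eventually.of_forall fun r => by positivity) ?_ tendsto_inv_atTop_zero
    filter_upwards [eventually_ge_atTop (1 : ℝ)] with r hr
    have hp := Real.two_le_pi
    rw [← mul_div_assoc, ← one_div, div_le_div_iff₀ (by positivity) (by positivity)]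
    have h3 : r ^ 3 ≤ (1 + r ^ 2) ^ 3 := pow_le_pow_left₀ (by positivity) (by nlinarith) 3
    have h4 : 0 ≤ (1 + r ^ 2) ^ 3 := by positivity
    nlinarith [mul_le_mul hp h3 (by positivity) (by positivity)]
  have e : Module.finrank ℝ E2 = 2 := by simp
  rw [e]
  exact h.comp tendsto_norm_cobounded_atTop

lemma tendsto_integral_peak {f g : E2 → ℂ} (hf : Continuous f) (hfs : HasCompactSupport f)
    (hg : Continuous g) (hgs : HasCompactSupport g) :
    Tendsto (fun c : ℝ => ∫ z, ∫ y, f y * g z * ((c ^ 2 * peak (c • (y - z)) : ℝ) : ℂ)) atTop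
      (𝓝 (∫ z, f z * g z)) := by
  have hfi : Integrable f := hf.integrable_of_hasCompactSupport hfs
  have hgi : Integrable g := hg.integrable_of_hasCompactSupport hgs
  have hI : Integrable (fun q : E2 × E2 => f (q.1 + q.2) * g q.1) (volume.prod volume) := by
    have := (measurePreserving_prod_add (volume : Measure E2) volume).integrable_comp_of_integrable
      (hgi.mul_prod hfi)
    refine this.congr (Eventually.of_forall fun q => ?_)
    simp [mul_comm]
  have hci : Integrable (fun w => ∫ z, f (z + w) * g z) := hI.integral_prod_right
  obtain ⟨C, hC⟩ := hf.bounded_above_of_compact_support hfs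
  have hcc : Continuous (fun w => ∫ z, f (z + w) * g z) := by
    refine continuous_of_dominated (bound := fun z => C * ‖g z‖) (fun w => ?_) (fun w => ?_)
      (hgi.norm.const_mul C) ?_
    · exact (by fun_prop : Continuous fun z => f (z + w) * g z).aestronglyMeasurable
    · refine Eventually.of_forall fun z => ?_
      rw [norm_mul]
      exact mul_le_mul_of_nonneg_right (hC _) (norm_nonneg _)
    · exact Eventually.of_forall fun z => by fun_prop
  have hlim := tendsto_integral_comp_smul_smul_of_integrable (μ := (volume : Measure E2))
    peak_nonneg integral_peak tendsto_norm_sq_mul_peak hci hcc.continuousAt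
  simp only [add_zero] at hlim
  refine hlim.congr fun c => ?_
  have e : Module.finrank ℝ E2 = 2 := by simp
  rw [e]
  have hp := continuous_peak
  have hJ : Integrable (fun q : E2 × E2 =>
      f (q.1 + q.2) * g q.1 * ((c ^ 2 * peak (c • q.2) : ℝ) : ℂ)) (volume.prod volume) := by
    refine hI.mul_bdd (c := c ^ 2 * (2 / π)) ?_ (Eventually.of_forall fun q => ?_)
    · exact (by fun_prop : Continuous fun q : E2 × E2 =>
        ((c ^ 2 * peak (c • q.2) : ℝ) : ℂ)).aestronglyMeasurable
    · rw [Complex.norm_real, Real.norm_of_nonneg (mul_nonneg (sq_nonneg c) (peak_nonneg _))]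
      refine mul_le_mul_of_nonneg_left ?_ (sq_nonneg c)
      unfold peak
      refine div_le_div_of_nonneg_left (by norm_num) Real.pi_pos ?_
      have : 1 ≤ (1 + ‖c • q.2‖ ^ 2) ^ 3 := one_le_pow₀ (by nlinarith [sq_nonneg ‖c • q.2‖])
      nlinarith [Real.pi_pos]
  calc ∫ w, (c ^ 2 * peak (c • w)) • ∫ z, f (z + w) * g z
      = ∫ w, ∫ z, f (z + w) * g z * ((c ^ 2 * peak (c • w) : ℝ) : ℂ) := by
        congr 1; funext w
        rw [integral_mul_const, Complex.real_smul, mul_comm]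
    _ = ∫ z, ∫ w, f (z + w) * g z * ((c ^ 2 * peak (c • w) : ℝ) : ℂ) :=
        (integral_integral_swap hJ).symm
    _ = ∫ z, ∫ y, f y * g z * ((c ^ 2 * peak (c • (y - z)) : ℝ) : ℂ) := by
        congr 1; funext z
        rw [← integral_add_left_eq_self
          (fun y => f y * g z * ((c ^ 2 * peak (c • (y - z)) : ℝ) : ℂ)) z]
        simp

lemma tendsto_integral_lap_regKernel {u v : E2 → ℂ} (hu : ContDiff ℝ (⊤ : ℕ∞) u)
    (hus : HasCompactSupport u) (hv : ContDiff ℝ (⊤ : ℕ∞) v) (hvs : HasCompactSupport v)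
    {J : ℂ} (hJ : J * J = -1) :
    Tendsto (fun c : ℝ => ∫ y, ∫ z, lap u y * lap v z * regKernel J c (y - z)) atTop
      (𝓝 (-(4 * π) * ∫ z, wd (-J) u z * wd (-J) v z)) := by
  have h := (tendsto_integral_peak (contDiff_wd hu (-J)).continuous (hasCompactSupport_wd hus (-J))
    (contDiff_wd hv (-J)).continuous (hasCompactSupport_wd hvs (-J))).const_mul (-(4 * π : ℂ))
  refine h.congr fun c => ?_
  have e := integral_wd_wd_kernel (contDiff_wd hu (-J)) (hasCompactSupport_wd hus (-J))
    (contDiff_wd hv (-J)) (hasCompactSupport_wd hvs (-J)) (contDiff_regKernel J c) J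
  simp only [wd_wd_neg hu hJ, wd_wd_neg hv hJ, wd_wd_regKernel_eq_peak hJ] at e
  rw [e, neg_mul, ← integral_const_mul]
  congr 2; funext z
  rw [← integral_const_mul]
  congr 1; funext y
  ring

lemma continuous_lap {u : E2 → ℂ} (hu : ContDiff ℝ (⊤ : ℕ∞) u) : Continuous (lap u) :=
  (contDiff_pd (contDiff_pd hu 0) 0).continuous.add (contDiff_pd (contDiff_pd hu 1) 1).continuous

lemma hasCompactSupport_lap {u : E2 → ℂ} (hu : HasCompactSupport u) : HasCompactSupport (lap u) :=
  (hasCompactSupport_pd (hasCompactSupport_pd hu 0) 0).add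
    (hasCompactSupport_pd (hasCompactSupport_pd hu 1) 1)

lemma pd_conj (u : E2 → ℂ) (i : Fin 2) :
    pd i (fun x => (starRingEnd ℂ) (u x)) = fun x => (starRingEnd ℂ) (pd i u x) := by
  funext x
  have h : fderiv ℝ (Complex.conjCLE ∘ u) x =
      (Complex.conjCLE : ℂ →L[ℝ] ℂ).comp (fderiv ℝ u x) := Complex.conjCLE.comp_fderiv
  have e : (fun x => (starRingEnd ℂ) (u x)) = Complex.conjCLE ∘ u := by
    funext y; simp
  rw [pd, e, h]
  simp [pd]

lemma norm_lap_conj (u : E2 → ℂ) (x : E2) :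
    ‖lap (fun x => (starRingEnd ℂ) (u x)) x‖ = ‖lap u x‖ := by
  simp only [lap, pd_conj]
  rw [← map_add, RCLike.norm_conj]

lemma norm_quadratic_le_iSup (A : Matrix (Fin 2) (Fin 2) ℂ) (x : E2) :
    ‖∑ i : Fin 2, ∑ j : Fin 2, A i j * (x i : ℂ) * (x j : ℂ)‖ ≤
      (⨆ ω : Metric.sphere (0 : E2) 1,
        ‖∑ i : Fin 2, ∑ j : Fin 2, A i j * ((ω : E2) i : ℂ) * ((ω : E2) j : ℂ)‖) * ‖x‖ ^ 2 := by
  rcases eq_or_ne x 0 with rfl | hx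
  · simp
  have hn : ‖x‖ ≠ 0 := norm_ne_zero_iff.mpr hx
  have hb : BddAbove (Set.range fun ω : Metric.sphere (0 : E2) 1 =>
      ‖∑ i : Fin 2, ∑ j : Fin 2, A i j * ((ω : E2) i : ℂ) * ((ω : E2) j : ℂ)‖) :=
    (isCompact_range (by fun_prop)).bddAbove
  have hω : ‖x‖⁻¹ • x ∈ Metric.sphere (0 : E2) 1 := by
    simp [norm_smul, hn]
  have h := le_ciSup hb ⟨_, hω⟩
  have e : ∑ i : Fin 2, ∑ j : Fin 2, A i j * (x i : ℂ) * (x j : ℂ) =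
      (∑ i : Fin 2, ∑ j : Fin 2, A i j * ((‖x‖⁻¹ • x) i : ℂ) * ((‖x‖⁻¹ • x) j : ℂ)) *
        ((‖x‖ ^ 2 : ℝ) : ℂ) := by
    have : (‖x‖ : ℂ) ≠ 0 := by exact_mod_cast hn
    simp only [Fin.sum_univ_two, PiLp.smul_apply, smul_eq_mul]
    push_cast
    field_simp
  rw [e, norm_mul, Complex.norm_real, Real.norm_of_nonneg (sq_nonneg ‖x‖)]
  exact mul_le_mul_of_nonneg_right h (sq_nonneg _)

/-- The regularised kernel of a trace-free form is bounded by the maximum of the form on the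
unit circle. -/
lemma norm_regKernel_comb_le (A : Matrix (Fin 2) (Fin 2) ℂ) (htr : A 0 0 + A 1 1 = 0) (c : ℝ)
    (x : E2) :
    ‖(A 0 0 / 2 + Complex.I * (A 0 1 + A 1 0) / 4) * regKernel Complex.I c x +
        (A 0 0 / 2 - Complex.I * (A 0 1 + A 1 0) / 4) * regKernel (-Complex.I) c x‖ ≤
      ⨆ ω : Metric.sphere (0 : E2) 1,
        ‖∑ i : Fin 2, ∑ j : Fin 2, A i j * ((ω : E2) i : ℂ) * ((ω : E2) j : ℂ)‖ := by
  have h := norm_quadratic_le_iSup A x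
  have hM : 0 ≤ ⨆ ω : Metric.sphere (0 : E2) 1,
      ‖∑ i : Fin 2, ∑ j : Fin 2, A i j * ((ω : E2) i : ℂ) * ((ω : E2) j : ℂ)‖ :=
    Real.iSup_nonneg fun _ => norm_nonneg _
  set M := ⨆ ω : Metric.sphere (0 : E2) 1,
      ‖∑ i : Fin 2, ∑ j : Fin 2, A i j * ((ω : E2) i : ℂ) * ((ω : E2) j : ℂ)‖
  have e : (A 0 0 / 2 + Complex.I * (A 0 1 + A 1 0) / 4) * regKernel Complex.I c x +
      (A 0 0 / 2 - Complex.I * (A 0 1 + A 1 0) / 4) * regKernel (-Complex.I) c x =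
      (c : ℂ) ^ 2 * (∑ i : Fin 2, ∑ j : Fin 2, A i j * (x i : ℂ) * (x j : ℂ)) /
        ((c ^ 2 * ‖x‖ ^ 2 + 1 : ℝ) : ℂ) := by
    simp only [regKernel, regKernel_den_eq, ← mul_div_assoc, ← add_div, Fin.sum_univ_two]
    congr 1
    have h1 : A 1 1 = -A 0 0 := by linear_combination htr
    rw [h1]
    linear_combination ((c : ℂ) ^ 2 * A 0 0 * (x 1 : ℂ) ^ 2 -
      (c : ℂ) ^ 2 * (A 0 1 + A 1 0) * (x 0 : ℂ) * (x 1 : ℂ)) * Complex.I_mul_I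
  have hc : 0 < c ^ 2 * ‖x‖ ^ 2 + 1 := by positivity
  rw [e, norm_div, norm_mul, Complex.norm_real, Real.norm_of_nonneg hc.le, div_le_iff₀ hc,
    norm_pow, Complex.norm_real, Real.norm_eq_abs, sq_abs]
  nlinarith [mul_le_mul_of_nonneg_left h (sq_nonneg c)]

lemma norm_integral_kernel_le {f g k : E2 → ℂ} {M : ℝ} (hf : Integrable f) (hg : Integrable g)
    (hk : ∀ x, ‖k x‖ ≤ M) :
    ‖∫ y, ∫ z, f y * g z * k (y - z)‖ ≤ M * ((∫ y, ‖f y‖) * ∫ z, ‖g z‖) := by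
  have h1 (y : E2) : ‖∫ z, f y * g z * k (y - z)‖ ≤ ‖f y‖ * (M * ∫ z, ‖g z‖) := by
    have : ‖f y‖ * (M * ∫ z, ‖g z‖) = ∫ z, ‖f y‖ * (M * ‖g z‖) := by
      rw [integral_const_mul, integral_const_mul]
    rw [this]
    refine norm_integral_le_of_norm_le ((hg.norm.const_mul M).const_mul _)
      (Eventually.of_forall fun z => ?_)
    rw [norm_mul, norm_mul, mul_assoc, mul_comm M]
    gcongr
    exact hk _
  refine (norm_integral_le_of_norm_le (hf.norm.mul_const _) (Eventually.of_forall h1)).trans ?_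
  rw [integral_mul_const]
  exact le_of_eq (by ring)

lemma integral_gradient_form_eq (A : Matrix (Fin 2) (Fin 2) ℂ) (htr : A 0 0 + A 1 1 = 0)
    {u v : E2 → ℂ} (hu : ContDiff ℝ (⊤ : ℕ∞) u) (hus : HasCompactSupport u)
    (hv : ContDiff ℝ (⊤ : ℕ∞) v) :
    ∫ x, ∑ i : Fin 2, ∑ j : Fin 2, A i j * pd i u x * pd j v x =
      (A 0 0 / 2 + Complex.I * (A 0 1 + A 1 0) / 4) *
          (∫ x, wd (-Complex.I) u x * wd (-Complex.I) v x) +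
        (A 0 0 / 2 - Complex.I * (A 0 1 + A 1 0) / 4) *
          ∫ x, wd Complex.I u x * wd Complex.I v x := by
  have hi (i j : Fin 2) : Integrable (fun x => pd i u x * pd j v x) :=
    ((contDiff_pd hu i).continuous.mul (contDiff_pd hv j).continuous).integrable_of_hasCompactSupport
      (hasCompactSupport_pd hus i).mul_right
  have hw (J : ℂ) : Integrable (fun x => wd J u x * wd J v x) :=
    ((contDiff_wd hu J).continuous.mul (contDiff_wd hv J).continuous).integrable_of_hasCompactSupport
      (hasCompactSupport_wd hus J).mul_right
  have hanti : ∫ x, pd 0 u x * pd 1 v x - pd 1 u x * pd 0 v x = 0 := by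
    rw [integral_sub (hi 0 1) (hi 1 0), integral_pd_mul hu hus (contDiff_pd hv 1),
      integral_pd_mul hu hus (contDiff_pd hv 0)]
    simp only [pd_comm hv, sub_self]
  have h1 : A 1 1 = -A 0 0 := by linear_combination htr
  have e : (fun x => ∑ i : Fin 2, ∑ j : Fin 2, A i j * pd i u x * pd j v x) = fun x =>
      (A 0 0 / 2 + Complex.I * (A 0 1 + A 1 0) / 4) * (wd (-Complex.I) u x * wd (-Complex.I) v x) +
      (A 0 0 / 2 - Complex.I * (A 0 1 + A 1 0) / 4) * (wd Complex.I u x * wd Complex.I v x) +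
      (A 0 1 - A 1 0) / 2 * (pd 0 u x * pd 1 v x - pd 1 u x * pd 0 v x) := by
    funext x
    simp only [Fin.sum_univ_two, wd, h1]
    linear_combination (-A 0 0 * pd 1 u x * pd 1 v x + (A 0 1 + A 1 0) / 2 *
      (pd 0 u x * pd 1 v x + pd 1 u x * pd 0 v x)) * Complex.I_mul_I
  have hanti_int : Integrable fun x => pd 0 u x * pd 1 v x - pd 1 u x * pd 0 v x :=
    (hi 0 1).sub (hi 1 0)
  have hsum (a b : ℂ) : Integrable fun x => a * (wd (-Complex.I) u x * wd (-Complex.I) v x) +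
      b * (wd Complex.I u x * wd Complex.I v x) :=
    ((hw _).const_mul _).add ((hw _).const_mul _)
  rw [e, integral_add (hsum _ _) (hanti_int.const_mul _),
    integral_add ((hw _).const_mul _) ((hw _).const_mul _), integral_const_mul,
    integral_const_mul, integral_const_mul, hanti]
  ring

/-- For a trace-free constant matrix `A`, the quadratic form of the gradient is estimated
by `(1/(4π)) max_{ω ∈ S¹} |Σ a_{ij} ω_i ω_j| (∫ |Δu|)²`. -/
theorem quadratic_form_gradient_estimate
    (A : Matrix (Fin 2) (Fin 2) ℂ) (htr : A 0 0 + A 1 1 = 0)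
    (u : E2 → ℂ) (hu : ContDiff ℝ (⊤ : ℕ∞) u) (hsupp : HasCompactSupport u) :
    ‖∫ x : E2, ∑ i : Fin 2, ∑ j : Fin 2,
        A i j * pd i u x * (starRingEnd ℂ) (pd j u x)‖ ≤
      (1 / (4 * π)) *
        (⨆ ω : Metric.sphere (0 : E2) 1,
          ‖∑ i : Fin 2, ∑ j : Fin 2, A i j * ((ω : E2) i : ℂ) * ((ω : E2) j : ℂ)‖) *
        (∫ x : E2, ‖lap u x‖) ^ 2 := by
  set M := ⨆ ω : Metric.sphere (0 : E2) 1,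
    ‖∑ i : Fin 2, ∑ j : Fin 2, A i j * ((ω : E2) i : ℂ) * ((ω : E2) j : ℂ)‖
  set v : E2 → ℂ := fun x => (starRingEnd ℂ) (u x) with hv_def
  have hv : ContDiff ℝ (⊤ : ℕ∞) v := Complex.conjCLE.contDiff.comp hu
  have hvs : HasCompactSupport v := hsupp.comp_left (map_zero _)
  set α := A 0 0 / 2 + Complex.I * (A 0 1 + A 1 0) / 4
  set β := A 0 0 / 2 - Complex.I * (A 0 1 + A 1 0) / 4
  set S := ∫ x : E2, ∑ i : Fin 2, ∑ j : Fin 2, A i j * pd i u x * (starRingEnd ℂ) (pd j u x)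
  have hS : S = α * (∫ x, wd (-Complex.I) u x * wd (-Complex.I) v x) +
      β * ∫ x, wd Complex.I u x * wd Complex.I v x := by
    rw [← integral_gradient_form_eq A htr hu hsupp hv]
    simp only [S, hv_def, pd_conj]
  have hl := continuous_lap hu
  have hl' := continuous_lap hv
  have hls := hasCompactSupport_lap hsupp
  have hls' := hasCompactSupport_lap hvs
  have hlim : Tendsto (fun c : ℝ => ∫ y, ∫ z, lap u y * lap v z *
      (fun x => α * regKernel Complex.I c x + β * regKernel (-Complex.I) c x) (y - z)) atTop
      (𝓝 (-(4 * π) * S)) := by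
    have h1 := (tendsto_integral_lap_regKernel hu hsupp hv hvs Complex.I_mul_I).const_mul α
    have h2 := (tendsto_integral_lap_regKernel hu hsupp hv hvs
      (J := -Complex.I) (by simp)).const_mul β
    have h3 := h1.add h2
    rw [neg_neg] at h3
    have e : α * (-(4 * π) * ∫ z, wd (-Complex.I) u z * wd (-Complex.I) v z) +
        β * (-(4 * π) * ∫ z, wd Complex.I u z * wd Complex.I v z) = -(4 * π) * S := by
      rw [hS]; ring
    rw [e] at h3
    refine h3.congr fun c => ?_
    have hk (J : ℂ) := integrable_kernel hl hls hl' hls' (contDiff_regKernel J c).continuous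
    have hint (J : ℂ) (y : E2) : Integrable fun z => lap u y * lap v z * regKernel J c (y - z) := by
      have hc := (contDiff_regKernel J c).continuous
      exact Continuous.integrable_of_hasCompactSupport (by fun_prop) hls'.mul_left.mul_right
    rw [← integral_const_mul, ← integral_const_mul,
      ← integral_add ((hk _).integral_prod_left.const_mul _)
        ((hk _).integral_prod_left.const_mul _)]
    congr 1; funext y
    rw [← integral_const_mul, ← integral_const_mul,
      ← integral_add ((hint _ y).const_mul _) ((hint _ y).const_mul _)]
    congr 1; funext z
    ring
  have hK : ∀ c x, ‖α * regKernel Complex.I c x + β * regKernel (-Complex.I) c x‖ ≤ M :=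
    norm_regKernel_comb_le A htr
  clear_value M
  have hle := le_of_tendsto hlim.norm (Eventually.of_forall fun c =>
    norm_integral_kernel_le (hl.integrable_of_hasCompactSupport hls)
      (hl'.integrable_of_hasCompactSupport hls') (hK c))
  simp only [v, norm_lap_conj] at hle
  rw [norm_mul, norm_neg, norm_mul, Complex.norm_real, Real.norm_of_nonneg Real.pi_pos.le] at hle
  norm_num at hle
  have hp := Real.pi_pos
  rw [one_div, mul_assoc, ← div_eq_inv_mul, le_div_iff₀ (by positivity)]
  calc ‖S‖ * (4 * π) = 4 * π * ‖S‖ := by ring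
    _ ≤ _ := hle
    _ = _ := by ring
end
end

section
/- Let A = (a_{ij})_{i,j=1}^{2} be a 2×2 matrix of constant complex entries. If there exists a constant C ≥ 0 such that |∫_{ℝ²} Σ_{i,j=1}^{2} a_{ij} (∂u/∂x_i)(conj(∂u/∂x_j)) dx| ≤ C (∫_{ℝ²} |Δu| dx)² for all complex-valued u ∈ C_0^∞(ℝ²), then the trace of A vanishes: a_{11} + a_{22} = 0. -/
open MeasureTheory
open scoped Real

noncomputable section

open Set Filter Topology Metric
open scoped ContDiff

lemma pd_ofReal_eq {g : E2 → ℝ} {g' : E2 →L[ℝ] ℝ} {x : E2} (hg : HasFDerivAt g g' x)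
    (i : Fin 2) :
    pd i (fun y => ((g y : ℝ) : ℂ)) x = ((g' (EuclideanSpace.single i 1) : ℝ) : ℂ) := by
  have h := (Complex.ofRealCLM.hasFDerivAt (x := g x)).comp x hg
  have h' : HasFDerivAt (fun y => ((g y : ℝ) : ℂ)) (Complex.ofRealCLM.comp g') x := h
  simp [pd, h'.fderiv]

lemma hasFDerivAt_comp_norm_sq {F : ℝ → ℝ} (hF : Differentiable ℝ F) (x : E2) :
    HasFDerivAt (fun y : E2 => F (‖y‖ ^ 2))
      (deriv F (‖x‖ ^ 2) • ((2 : ℕ) • innerSL ℝ x)) x := by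
  have h := (hasStrictFDerivAt_norm_sq x).hasFDerivAt
  have h2 := (hF (‖x‖ ^ 2)).hasDerivAt.comp_hasFDerivAt x h
  simpa [Function.comp_def] using h2

lemma pd_comp_norm_sq {F : ℝ → ℝ} (hF : Differentiable ℝ F) (i : Fin 2) :
    pd i (fun y : E2 => ((F (‖y‖ ^ 2) : ℝ) : ℂ)) =
      fun x => ((2 * x i * deriv F (‖x‖ ^ 2) : ℝ) : ℂ) := by
  funext x
  rw [pd_ofReal_eq (hasFDerivAt_comp_norm_sq hF x)]
  congr 1
  simp [EuclideanSpace.inner_single_right]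
  ring

lemma lap_comp_norm_sq {F : ℝ → ℝ} (hF : Differentiable ℝ F)
    (hF' : Differentiable ℝ (deriv F)) (x : E2) :
    lap (fun y : E2 => ((F (‖y‖ ^ 2) : ℝ) : ℂ)) x =
      ((4 * (deriv F (‖x‖ ^ 2) + ‖x‖ ^ 2 * deriv (deriv F) (‖x‖ ^ 2)) : ℝ) : ℂ) := by
  have key (i : Fin 2) : pd i (pd i (fun y : E2 => ((F (‖y‖ ^ 2) : ℝ) : ℂ))) x =
      ((2 * deriv F (‖x‖ ^ 2) + 4 * x i ^ 2 * deriv (deriv F) (‖x‖ ^ 2) : ℝ) : ℂ) := by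
    rw [pd_comp_norm_sq hF]
    have h1 : HasFDerivAt (fun y : E2 => 2 * y i)
        ((2 : ℝ) • (EuclideanSpace.proj i : E2 →L[ℝ] ℝ)) x :=
      ((EuclideanSpace.proj i : E2 →L[ℝ] ℝ).hasFDerivAt (x := x)).const_mul 2
    refine (pd_ofReal_eq (h1.mul (hasFDerivAt_comp_norm_sq hF' x)) i).trans ?_
    congr 1
    simp [EuclideanSpace.inner_single_right]
    ring
  have hn : ‖x‖ ^ 2 = x 0 ^ 2 + x 1 ^ 2 := by
    simp [EuclideanSpace.norm_sq_eq, Fin.sum_univ_two]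
  rw [lap, key, key, ← Complex.ofReal_add]
  congr 1
  linear_combination (-4 * deriv (deriv F) (‖x‖ ^ 2)) * hn

/-- Rotation of the plane by a right angle. -/
def rotJ : E2 ≃ₗᵢ[ℝ] E2 :=
  LinearIsometry.toLinearIsometryEquiv
    { toFun := fun x => !₂[-x 1, x 0]
      map_add' := fun x y => by ext i; fin_cases i <;> simp [add_comm]
      map_smul' := fun c x => by ext i; fin_cases i <;> simp
      norm_map' := fun x => by
        simp [EuclideanSpace.norm_eq, Fin.sum_univ_two, add_comm] } rfl

lemma rotJ_apply_zero (x : E2) : rotJ x 0 = -x 1 := rfl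

lemma rotJ_apply_one (x : E2) : rotJ x 1 = x 0 := rfl

lemma eq_zero_of_norm_gt {H : ℝ → ℝ} (h0 : ∀ s, 2 ≤ s → H s = 0) {x : E2}
    (hx : x ∉ closedBall (0 : E2) 2) : H (‖x‖ ^ 2) = 0 := by
  rw [mem_closedBall_zero_iff, not_le] at hx
  exact h0 _ (by nlinarith)

lemma two_mul_integral_quadratic_form {F : ℝ → ℝ} (hF : ContDiff ℝ ∞ F)
    (h0 : ∀ s, 2 ≤ s → deriv F s = 0) (A : Matrix (Fin 2) (Fin 2) ℂ) :
    2 * ∫ x : E2, ∑ i : Fin 2, ∑ j : Fin 2,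
        A i j * pd i (fun y : E2 => ((F (‖y‖ ^ 2) : ℝ) : ℂ)) x *
          (starRingEnd ℂ) (pd j (fun y : E2 => ((F (‖y‖ ^ 2) : ℝ) : ℂ)) x) =
      (A 0 0 + A 1 1) *
        ((∫ x : E2, 4 * (‖x‖ ^ 2 * deriv F (‖x‖ ^ 2) ^ 2) : ℝ) : ℂ) := by
  have hd := (contDiff_infty_iff_deriv.1 hF).1
  have hc : Continuous (deriv F) := (contDiff_infty_iff_deriv.1 hF).2.continuous
  simp only [pd_comp_norm_sq hd, Complex.conj_ofReal]
  set P : E2 → ℂ := fun x => ∑ i : Fin 2, ∑ j : Fin 2,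
    A i j * ((2 * x i * deriv F (‖x‖ ^ 2) : ℝ) : ℂ) *
      ((2 * x j * deriv F (‖x‖ ^ 2) : ℝ) : ℂ) with hP
  have hPc : Continuous P := by
    rw [hP]
    fun_prop
  have hPs : HasCompactSupport P := by
    refine HasCompactSupport.intro (isCompact_closedBall (0 : E2) 2) fun x hx => ?_
    simp [hP, eq_zero_of_norm_gt h0 hx]
  have hPi : Integrable P := hPc.integrable_of_hasCompactSupport hPs
  have hmp : MeasurePreserving rotJ (volume : Measure E2) volume := rotJ.measurePreserving
  have hemb : MeasurableEmbedding rotJ := rotJ.toHomeomorph.measurableEmbedding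
  have hrot : ∫ x, P (rotJ x) = ∫ x, P x := hmp.integral_comp hemb P
  have hPi' : Integrable (fun x => P (rotJ x)) := (hmp.integrable_comp_emb hemb).2 hPi
  rw [two_mul]
  nth_rewrite 2 [← hrot]
  rw [← integral_add hPi hPi', ← integral_complex_ofReal, ← integral_const_mul]
  congr 1
  funext x
  have hn : ‖x‖ ^ 2 = x 0 ^ 2 + x 1 ^ 2 := by
    simp [EuclideanSpace.norm_sq_eq, Fin.sum_univ_two]
  simp only [hP, Fin.sum_univ_two, rotJ_apply_zero, rotJ_apply_one,
    LinearIsometryEquiv.norm_map]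
  generalize deriv F (‖x‖ ^ 2) = d
  rw [hn]
  push_cast
  ring

/-- A smooth plateau function, supported in `[R⁻¹, 2]` and equal to `1` on `[2 / R, 1]`. -/
def plateau (R s : ℝ) : ℝ :=
  Real.smoothTransition (R * s - 1) - Real.smoothTransition (s - 1)

lemma contDiff_plateau (R : ℝ) : ContDiff ℝ ∞ (plateau R) := by
  have h : ContDiff ℝ ∞ Real.smoothTransition := Real.smoothTransition.contDiff (n := ⊤)
  exact (h.comp (by fun_prop)).sub (h.comp (by fun_prop))

lemma hasDerivAt_smoothTransition_affine (R s : ℝ) :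
    HasDerivAt (fun s => Real.smoothTransition (R * s - 1))
      (R * deriv Real.smoothTransition (R * s - 1)) s := by
  have h : ContDiff ℝ ∞ Real.smoothTransition := Real.smoothTransition.contDiff (n := ⊤)
  have h1 := ((h.differentiable (by simp)) (R * s - 1)).hasDerivAt
  have h2 : HasDerivAt (fun s : ℝ => R * s - 1) R s := by
    simpa using ((hasDerivAt_id s).const_mul R).sub_const 1
  simpa [mul_comm, Function.comp_def] using h1.comp s h2

lemma deriv_plateau (R s : ℝ) : deriv (plateau R) s =
    R * deriv Real.smoothTransition (R * s - 1) -
      1 * deriv Real.smoothTransition (1 * s - 1) := by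
  have h := (hasDerivAt_smoothTransition_affine R s).sub
    (hasDerivAt_smoothTransition_affine 1 s)
  rw [← h.deriv]
  congr 1
  funext t
  simp [plateau]

lemma exists_radial_profile {R : ℝ} (hR : 1 ≤ R) : ∃ F : ℝ → ℝ, ContDiff ℝ ∞ F ∧
    (∀ s, 2 ≤ s → F s = 0) ∧ (∀ s, 2 ≤ s → deriv F s = 0) ∧
    ∀ s, s * deriv F s = plateau R s := by
  have hsmall : ∀ s, s ≤ R⁻¹ → plateau R s = 0 := fun s hs => by
    have h1 : R * s ≤ 1 := by
      have := mul_le_mul_of_nonneg_left hs (by linarith : (0 : ℝ) ≤ R)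
      rwa [mul_inv_cancel₀ (by linarith)] at this
    have h2 : s ≤ 1 := hs.trans (inv_le_one_of_one_le₀ hR)
    rw [plateau, Real.smoothTransition.zero_of_nonpos (by linarith),
      Real.smoothTransition.zero_of_nonpos (by linarith), sub_zero]
  have hlarge : ∀ s, 2 ≤ s → plateau R s = 0 := fun s hs => by
    rw [plateau, Real.smoothTransition.one_of_one_le (by nlinarith),
      Real.smoothTransition.one_of_one_le (by linarith), sub_self]
  have hRpos : 0 < R⁻¹ := inv_pos.2 (by linarith)
  set H : ℝ → ℝ := fun s => plateau R s * s⁻¹ with hH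
  have hHs : ContDiff ℝ ∞ H := by
    rw [contDiff_iff_contDiffAt]
    intro s
    rcases eq_or_ne s 0 with rfl | hs
    · have : H =ᶠ[𝓝 0] fun _ => 0 := by
        filter_upwards [Iio_mem_nhds hRpos] with t ht
        simp [hH, hsmall t (le_of_lt ht)]
      exact contDiffAt_const.congr_of_eventuallyEq this
    · exact (contDiff_plateau R).contDiffAt.mul (contDiffAt_inv ℝ hs)
  have hH2 : ∀ s, 2 ≤ s → H s = 0 := fun s hs => by simp [hH, hlarge s hs]
  have hder : ∀ s, HasDerivAt (fun s => ∫ t in (2 : ℝ)..s, H t) (H s) s := fun s =>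
    intervalIntegral.integral_hasDerivAt_right (hHs.continuous.intervalIntegrable _ _)
      hHs.continuous.stronglyMeasurable.stronglyMeasurableAtFilter hHs.continuous.continuousAt
  have hderiv : deriv (fun s => ∫ t in (2 : ℝ)..s, H t) = H := funext fun s => (hder s).deriv
  refine ⟨fun s => ∫ t in (2 : ℝ)..s, H t, ?_, ?_, ?_, ?_⟩
  · rw [contDiff_infty_iff_deriv, hderiv]
    exact ⟨fun s => (hder s).differentiableAt, hHs⟩
  · intro s hs
    refine (intervalIntegral.integral_congr (g := fun _ => (0 : ℝ)) fun t ht => ?_).trans (by simp)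
    rw [uIcc_of_le hs] at ht
    exact hH2 t ht.1
  · rw [hderiv]
    exact hH2
  · intro s
    rw [hderiv]
    rcases eq_or_ne s 0 with rfl | hs
    · simp [hsmall 0 hRpos.le]
    · simp only [hH]
      field_simp

lemma smoothTransition_radial_integral {R : ℝ} (hR : 1 ≤ R) :
    IntegrableOn (fun r : ℝ => r * (R * deriv Real.smoothTransition (R * r ^ 2 - 1))) (Ioi 0) ∧
    ∫ r in Ioi (0 : ℝ), r * (R * deriv Real.smoothTransition (R * r ^ 2 - 1)) = 1 / 2 := by
  have hder : ∀ r ∈ Ici (0 : ℝ), HasDerivAt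
      (fun r => 1 / 2 * Real.smoothTransition (R * r ^ 2 - 1))
      (r * (R * deriv Real.smoothTransition (R * r ^ 2 - 1))) r := fun r _ => by
    have h := ((hasDerivAt_smoothTransition_affine R (r ^ 2)).comp r
      (hasDerivAt_pow 2 r)).const_mul (1 / 2)
    refine h.congr_deriv ?_
    norm_num
    ring
  have hpos : ∀ r ∈ Ioi (0 : ℝ),
      0 ≤ r * (R * deriv Real.smoothTransition (R * r ^ 2 - 1)) := fun r hr =>
    mul_nonneg (le_of_lt hr) (mul_nonneg (by linarith)
      Real.smoothTransition.monotone.deriv_nonneg)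
  have hlim : Tendsto (fun r => 1 / 2 * Real.smoothTransition (R * r ^ 2 - 1)) atTop
      (𝓝 (1 / 2)) := by
    refine tendsto_const_nhds.congr' ?_
    filter_upwards [eventually_ge_atTop (2 : ℝ)] with r hr
    rw [Real.smoothTransition.one_of_one_le (by nlinarith), mul_one]
  refine ⟨integrableOn_Ioi_deriv_of_nonneg' hder hpos hlim, ?_⟩
  rw [integral_Ioi_of_hasDerivAt_of_nonneg' hder hpos hlim]
  simp [Real.smoothTransition.zero_of_nonpos]

lemma integral_norm_lap_le {R : ℝ} (hR : 1 ≤ R) {F : ℝ → ℝ} (hF : ContDiff ℝ ∞ F)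
    (hG : ∀ s, s * deriv F s = plateau R s) :
    ∫ x : E2, ‖lap (fun y : E2 => ((F (‖y‖ ^ 2) : ℝ) : ℂ)) x‖ ≤
      8 * volume.real (ball (0 : E2) 1) := by
  have hF1 := contDiff_infty_iff_deriv.1 hF
  have hF2 := contDiff_infty_iff_deriv.1 hF1.2
  have hdG : ∀ s, deriv F s + s * deriv (deriv F) s = deriv (plateau R) s := fun s => by
    have h := (hasDerivAt_id s).mul (hF2.1 s).hasDerivAt
    have he : (id * deriv F : ℝ → ℝ) = plateau R := funext hG
    rw [he] at h
    rw [h.deriv]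
    simp
  set D : ℝ → ℝ → ℝ := fun R r => R * deriv Real.smoothTransition (R * r ^ 2 - 1) with hD
  have hD0 : ∀ {R : ℝ}, 1 ≤ R → ∀ r, 0 ≤ D R r := fun hR r =>
    mul_nonneg (by linarith) Real.smoothTransition.monotone.deriv_nonneg
  have hfin : Module.finrank ℝ E2 = 2 := by simp
  have hDint : ∀ {R : ℝ}, 1 ≤ R → Integrable (fun x : E2 => D R ‖x‖) ∧
      ∫ x : E2, D R ‖x‖ = volume.real (ball (0 : E2) 1) := fun {R} hR => by
    obtain ⟨h1, h2⟩ := smoothTransition_radial_integral hR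
    constructor
    · rw [integrable_fun_norm_addHaar volume (f := D R), hfin]
      simpa using h1
    · rw [integral_fun_norm_addHaar volume (D R), hfin]
      simp only [Nat.add_one_sub_one, pow_one, smul_eq_mul, hD, h2, nsmul_eq_mul]
      push_cast
      ring
  have hb : ∀ x : E2, ‖lap (fun y : E2 => ((F (‖y‖ ^ 2) : ℝ) : ℂ)) x‖ ≤
      4 * (D R ‖x‖ + D 1 ‖x‖) := fun x => by
    rw [lap_comp_norm_sq hF1.1 hF2.1, hdG, deriv_plateau, Complex.norm_real, norm_mul,
      Real.norm_of_nonneg (by norm_num : (0 : ℝ) ≤ 4)]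
    refine mul_le_mul_of_nonneg_left ((norm_sub_le _ _).trans (le_of_eq ?_)) (by norm_num)
    congr 1
    · exact Real.norm_of_nonneg (hD0 hR _)
    · exact Real.norm_of_nonneg (hD0 le_rfl _)
  obtain ⟨hi, he⟩ := hDint hR
  obtain ⟨hi1, he1⟩ := hDint le_rfl
  refine (integral_mono_of_nonneg (.of_forall fun x => norm_nonneg _)
    ((hi.add hi1).const_mul 4) (.of_forall hb)).trans (le_of_eq ?_)
  simp only [Pi.add_apply]
  rw [integral_const_mul, integral_add hi hi1, he, he1]
  ring

lemma le_integral_gradient_sq {R : ℝ} (hR : 2 ≤ R) {F : ℝ → ℝ} (hF : ContDiff ℝ ∞ F)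
    (h0 : ∀ s, 2 ≤ s → deriv F s = 0) (hG : ∀ s, s * deriv F s = plateau R s) :
    4 * volume.real (ball (0 : E2) 1) * Real.log (R / 2) ≤
      ∫ x : E2, 4 * (‖x‖ ^ 2 * deriv F (‖x‖ ^ 2) ^ 2) := by
  have hc : Continuous (deriv F) := (contDiff_infty_iff_deriv.1 hF).2.continuous
  have hfin : Module.finrank ℝ E2 = 2 := by simp
  set f : ℝ → ℝ := fun r => 4 * (r ^ 2 * deriv F (r ^ 2) ^ 2) with hf
  have hint : Integrable (fun x : E2 => f ‖x‖) := by
    refine Continuous.integrable_of_hasCompactSupport (by rw [hf]; fun_prop)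
      (HasCompactSupport.intro (isCompact_closedBall (0 : E2) 2) fun x hx => ?_)
    simp [hf, eq_zero_of_norm_gt h0 hx]
  rw [integrable_fun_norm_addHaar volume (f := f), hfin] at hint
  change _ ≤ ∫ x : E2, f ‖x‖
  rw [integral_fun_norm_addHaar volume f, hfin]
  simp only [Nat.add_one_sub_one, pow_one, smul_eq_mul, nsmul_eq_mul] at hint ⊢
  set a : ℝ := √(2 / R) with ha
  have hapos : 0 < a := Real.sqrt_pos.2 (by positivity)
  have hasq : a ^ 2 = 2 / R := Real.sq_sqrt (by positivity)
  have ha1 : a ≤ 1 := Real.sqrt_le_one.2 (by rw [div_le_one (by linarith)]; exact hR)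
  have hval : ∫ r in Ioc a 1, r * f r = 2 * Real.log (R / 2) := by
    rw [← intervalIntegral.integral_of_le ha1]
    have : ∫ r in a..1, r * f r = ∫ r in a..1, 4 * r⁻¹ := by
      refine intervalIntegral.integral_congr fun r hr => ?_
      rw [uIcc_of_le ha1] at hr
      have hr0 : 0 < r := hapos.trans_le hr.1
      have hlow : 2 / R ≤ r ^ 2 := hasq ▸ pow_le_pow_left₀ hapos.le hr.1 2
      rw [div_le_iff₀ (by linarith)] at hlow
      have hp : r ^ 2 * deriv F (r ^ 2) = 1 := by
        rw [hG, plateau, Real.smoothTransition.one_of_one_le (by linarith),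
          Real.smoothTransition.zero_of_nonpos (by nlinarith [hr.2]), sub_zero]
      have hd : deriv F (r ^ 2) = (r ^ 2)⁻¹ := eq_inv_of_mul_eq_one_right hp
      simp only [hf, hd]
      field_simp
    rw [this, intervalIntegral.integral_const_mul, integral_inv_of_pos hapos one_pos, one_div,
      Real.log_inv, ha, Real.log_sqrt (by positivity), ← inv_div R 2, Real.log_inv]
    ring
  have hmono : ∫ r in Ioc a 1, r * f r ≤ ∫ r in Ioi (0 : ℝ), r * f r := by
    refine setIntegral_mono_set hint ?_ (LE.le.eventuallyLE
      (Ioc_subset_Ioi_self.trans (Ioi_subset_Ioi hapos.le)))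
    filter_upwards [ae_restrict_mem measurableSet_Ioi] with r hr
    have : (0 : ℝ) < r := hr
    simp only [hf, Pi.zero_apply]
    positivity
  rw [hval] at hmono
  have hV : 0 ≤ volume.real (ball (0 : E2) 1) := measureReal_nonneg
  push_cast
  nlinarith [mul_le_mul_of_nonneg_left hmono hV]

/-- If the quadratic form of the gradient is estimated by a constant times `(∫ |Δu|)²`
for all test functions, then the matrix `A` is trace free. -/
theorem trace_free_necessary
    (A : Matrix (Fin 2) (Fin 2) ℂ) (C : ℝ) (hC : 0 ≤ C)
    (h : ∀ u : E2 → ℂ, ContDiff ℝ (⊤ : ℕ∞) u → HasCompactSupport u →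
      ‖∫ x : E2, ∑ i : Fin 2, ∑ j : Fin 2,
          A i j * pd i u x * (starRingEnd ℂ) (pd j u x)‖ ≤
        C * (∫ x : E2, ‖lap u x‖) ^ 2) :
    A 0 0 + A 1 1 = 0 := by
  set V := volume.real (ball (0 : E2) 1) with hV
  have hVpos : 0 < V :=
    ENNReal.toReal_pos (measure_ball_pos _ _ one_pos).ne' measure_ball_lt_top.ne
  have bound : ∀ R : ℝ, 2 ≤ R →
      ‖A 0 0 + A 1 1‖ * (4 * V * Real.log (R / 2)) ≤ 2 * (C * (8 * V) ^ 2) := by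
    intro R hR
    obtain ⟨F, hF, hF0, hF0', hG⟩ := exists_radial_profile (by linarith : (1 : ℝ) ≤ R)
    have hu := h (fun y : E2 => ((F (‖y‖ ^ 2) : ℝ) : ℂ))
      (Complex.ofRealCLM.contDiff.comp (hF.comp (contDiff_norm_sq ℝ)))
      (HasCompactSupport.intro (isCompact_closedBall (0 : E2) 2) fun x hx => by
        simp [eq_zero_of_norm_gt hF0 hx])
    have hq := congrArg norm (two_mul_integral_quadratic_form hF hF0' A)
    have hlap := integral_norm_lap_le (by linarith : (1 : ℝ) ≤ R) hF hG
    have hgrad := le_integral_gradient_sq hR hF hF0' hG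
    rw [norm_mul, norm_mul, Complex.norm_real, Complex.norm_two] at hq
    calc ‖A 0 0 + A 1 1‖ * (4 * V * Real.log (R / 2))
        ≤ ‖A 0 0 + A 1 1‖ * ‖∫ x : E2, 4 * (‖x‖ ^ 2 * deriv F (‖x‖ ^ 2) ^ 2)‖ := by
          gcongr
          exact hgrad.trans (Real.le_norm_self _)
      _ = _ := hq.symm
      _ ≤ 2 * (C * (8 * V) ^ 2) := by
          gcongr
          refine hu.trans ?_
          gcongr
  by_contra hne
  have htr : 0 < ‖A 0 0 + A 1 1‖ := norm_pos_iff.2 hne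
  have hlim : Tendsto (fun R : ℝ => ‖A 0 0 + A 1 1‖ * (4 * V * Real.log (R / 2))) atTop atTop :=
    ((Real.tendsto_log_atTop.comp (tendsto_id.atTop_div_const two_pos)).const_mul_atTop
      (by positivity)).const_mul_atTop htr
  obtain ⟨R, hR, hR2⟩ :=
    ((hlim.eventually_gt_atTop (2 * (C * (8 * V) ^ 2))).and (eventually_ge_atTop 2)).exists
  exact absurd (bound R hR2) (not_le.2 hR)
end
end
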